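/- arXiv:2012.08365 — 3 statements merged into one kernel-verified Lean document; each statement's English description precedes it below -/
import Mathlib

section
/- Let ABCD be an arbitrary quadrilateral in the Euclidean plane whose diagonals AC and BD meet at a point P. Let O_a, O_b, O_c, O_d be the circumcenters of triangles BCD, CDA, DAB, ABC respectively (each triple of points being non-collinear). Let M be the midpoint of segment O_aO_c and N the midpoint of segment O_bO_d, with M ≠ N. Let the line through P perpendicular to the line MN meet line AB at Q and line CD at R (assume these intersections exist). Then P is the midpoint of the segment QR. -/
open scoped InnerProductSpace

/-- A point on the line through two distinct points. -/
lemma bf_line {X Y Z : EuclideanSpace ℝ (Fin 2)} (h : X ≠ Y)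
    (hc : Collinear ℝ ({X, Y, Z} : Set (EuclideanSpace ℝ (Fin 2)))) :
    ∃ r : ℝ, Z = X + r • (Y - X) := by
  rw [collinear_iff_of_mem (p₀ := X) (by simp)] at hc
  obtain ⟨v, hv⟩ := hc
  obtain ⟨s, hs⟩ := hv Y (by simp)
  obtain ⟨t, ht⟩ := hv Z (by simp)
  simp only [vadd_eq_add] at hs ht
  have hs0 : s ≠ 0 := by
    rintro rfl
    apply h
    simp [hs]
  refine ⟨t / s, ?_⟩
  rw [ht, hs, add_sub_cancel_right, smul_smul, div_mul_cancel₀ _ hs0, add_comm]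

lemma bf_coll {X Y Z : EuclideanSpace ℝ (Fin 2)} (r : ℝ) (h : Z = X + r • (Y - X)) :
    Collinear ℝ ({X, Y, Z} : Set (EuclideanSpace ℝ (Fin 2))) := by
  rw [collinear_iff_of_mem (p₀ := X) (by simp)]
  refine ⟨Y - X, ?_⟩
  intro p hp
  simp only [Set.mem_insert_iff, Set.mem_singleton_iff] at hp
  rcases hp with rfl | rfl | rfl
  · exact ⟨0, by simp⟩
  · exact ⟨1, by simp⟩
  · exact ⟨r, by rw [h, vadd_eq_add, add_comm]⟩

/-- Non-collinear points have nonzero signed area. -/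
lemma bf_det {X Y Z : EuclideanSpace ℝ (Fin 2)} (h : X ≠ Y)
    (hc : ¬ Collinear ℝ ({X, Y, Z} : Set (EuclideanSpace ℝ (Fin 2)))) :
    (Y 0 - X 0) * (Z 1 - X 1) - (Y 1 - X 1) * (Z 0 - X 0) ≠ 0 := by
  intro hd
  apply hc
  by_cases h0 : Y 0 - X 0 = 0
  · have h1 : Y 1 - X 1 ≠ 0 := by
      intro h1
      apply h
      ext i
      fin_cases i <;> simp <;> linarith
    apply bf_coll ((Z 1 - X 1) / (Y 1 - X 1))
    ext i
    fin_cases i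
    · simp only [Fin.zero_eta, PiLp.add_apply, PiLp.smul_apply, PiLp.sub_apply, smul_eq_mul]
      field_simp
      linarith
    · simp only [Fin.mk_one, PiLp.add_apply, PiLp.smul_apply, PiLp.sub_apply, smul_eq_mul]
      field_simp
      ring
  · apply bf_coll ((Z 0 - X 0) / (Y 0 - X 0))
    ext i
    fin_cases i
    · simp only [Fin.zero_eta, PiLp.add_apply, PiLp.smul_apply, PiLp.sub_apply, smul_eq_mul]
      field_simp
      ring
    · simp only [Fin.mk_one, PiLp.add_apply, PiLp.smul_apply, PiLp.sub_apply, smul_eq_mul]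
      field_simp
      linarith

lemma bf_dist {O X Y : EuclideanSpace ℝ (Fin 2)} (h : dist O X = dist O Y) :
    (O 0 - X 0) ^ 2 + (O 1 - X 1) ^ 2 = (O 0 - Y 0) ^ 2 + (O 1 - Y 1) ^ 2 := by
  have h2 : dist O X ^ 2 = dist O Y ^ 2 := by rw [h]
  simpa [EuclideanSpace.dist_sq_eq, Real.dist_eq, sq_abs, Fin.sum_univ_two] using h2

/-- Directional component of a circumcenter: the circle through `a u`, `c u`, `b v`, where
`s`, `t` are the inner products of its center with `u`, `v`. -/
lemma bf_circ {a b c U V s t : ℝ} (hb : b ≠ 0) (hac : a ≠ c)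
    (h1 : a ^ 2 * U - 2 * a * s = b ^ 2 * V - 2 * b * t)
    (h2 : a ^ 2 * U - 2 * a * s = c ^ 2 * U - 2 * c * s) :
    2 * s = (a + c) * U ∧ 2 * t = b * V + a * c * U / b := by
  have h3 : 2 * s = (a + c) * U := by
    apply mul_left_cancel₀ (sub_ne_zero.mpr hac)
    linarith
  refine ⟨h3, ?_⟩
  field_simp
  linear_combination h1 + a * h3

/-- The scalar core. -/
lemma bf_core {a b c d K wu wv x y : ℝ} (ha : a ≠ 0) (hb : b ≠ 0) (hc : c ≠ 0) (hd : d ≠ 0)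
    (hw : ¬ (wu = 0 ∧ wv = 0))
    (hu : wu = K * ((a + c) / (a * c))) (hv : wv = K * ((b + d) / (b * d)))
    (hQ : (1 - x) * a * wu + x * b * wv = 0) (hR : (1 - y) * c * wu + y * d * wv = 0) :
    (1 - x) * a + (1 - y) * c = 0 ∧ x * b + y * d = 0 := by
  have hK : K ≠ 0 := by
    rintro rfl
    exact hw ⟨by simp [hu], by simp [hv]⟩
  have hQ' : (1 - x) * (a + c) * d + x * (b + d) * c = 0 := by
    rw [hu, hv] at hQ
    field_simp at hQ
    apply mul_left_cancel₀ hK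
    linarith
  have hR' : (1 - y) * (a + c) * b + y * (b + d) * a = 0 := by
    rw [hu, hv] at hR
    field_simp at hR
    apply mul_left_cancel₀ hK
    linarith
  have hE : a * d - b * c ≠ 0 := by
    intro hE
    have h1 : d * (a + c) = 0 := by linear_combination hQ' + x * hE
    have h2 : a + c = 0 := (mul_eq_zero.mp h1).resolve_left hd
    have h3 : a * (b + d) = 0 := by linear_combination hE + b * h2
    have h4 : b + d = 0 := (mul_eq_zero.mp h3).resolve_left ha
    exact hw ⟨by rw [hu, h2]; simp, by rw [hv, h4]; simp⟩
  constructor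
  · apply mul_left_cancel₀ hE
    linear_combination a * hQ' - c * hR'
  · apply mul_left_cancel₀ hE
    linear_combination d * hR' - b * hQ'

/-- **The first generalization of the Butterfly Theorem.** Let `ABCD` be an arbitrary
quadrilateral whose diagonals `AC` and `BD` meet at `P`.  Let `Oa`, `Ob`, `Oc`, `Od`
be the circumcenters of triangles `BCD`, `CDA`, `DAB`, `ABC`, let `M`, `N` be the
midpoints of `OaOc` and `ObOd`.  The line through `P` perpendicular to `MN` meets line
`AB` at `Q` and line `CD` at `R`.  Then `P` is the midpoint of `QR`. -/
theorem butterfly_first_generalization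
    (A B C D P Oa Ob Oc Od M N Q R : EuclideanSpace ℝ (Fin 2))
    (hAB : A ≠ B) (hAC : A ≠ C) (hAD : A ≠ D) (hBC : B ≠ C) (hBD : B ≠ D) (hCD : C ≠ D)
    (hABC : ¬ Collinear ℝ ({A, B, C} : Set (EuclideanSpace ℝ (Fin 2))))
    (hABD : ¬ Collinear ℝ ({A, B, D} : Set (EuclideanSpace ℝ (Fin 2))))
    (hACD : ¬ Collinear ℝ ({A, C, D} : Set (EuclideanSpace ℝ (Fin 2))))
    (hBCD : ¬ Collinear ℝ ({B, C, D} : Set (EuclideanSpace ℝ (Fin 2))))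
    (hPAC : Collinear ℝ ({A, C, P} : Set (EuclideanSpace ℝ (Fin 2))))
    (hPBD : Collinear ℝ ({B, D, P} : Set (EuclideanSpace ℝ (Fin 2))))
    (hOa : dist Oa B = dist Oa C ∧ dist Oa C = dist Oa D)
    (hOb : dist Ob C = dist Ob D ∧ dist Ob D = dist Ob A)
    (hOc : dist Oc D = dist Oc A ∧ dist Oc A = dist Oc B)
    (hOd : dist Od A = dist Od B ∧ dist Od B = dist Od C)
    (hM : M = midpoint ℝ Oa Oc) (hN : N = midpoint ℝ Ob Od) (hMN : M ≠ N)
    (hQAB : Collinear ℝ ({A, B, Q} : Set (EuclideanSpace ℝ (Fin 2))))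
    (hQperp : ⟪Q - P, N - M⟫_ℝ = 0)
    (hRCD : Collinear ℝ ({C, D, R} : Set (EuclideanSpace ℝ (Fin 2))))
    (hRperp : ⟪R - P, N - M⟫_ℝ = 0) :
    P = midpoint ℝ Q R := by
  obtain ⟨r, hr⟩ := bf_line hAC hPAC
  obtain ⟨s, hs⟩ := bf_line hBD hPBD
  obtain ⟨x, hx⟩ := bf_line hAB hQAB
  obtain ⟨y, hy⟩ := bf_line hCD hRCD
  have dABC := bf_det hAB hABC
  have dABD := bf_det hAB hABD
  have dACD := bf_det hAC hACD
  have dBCD := bf_det hBC hBCD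
  have a1 := bf_dist hOa.1
  have a2 := bf_dist hOa.2
  have b1 := bf_dist hOb.1
  have b2 := bf_dist hOb.2
  have c1 := bf_dist hOc.1
  have c2 := bf_dist hOc.2
  have d1 := bf_dist hOd.1
  have d2 := bf_dist hOd.2
  have r0 : P 0 = A 0 + r * (C 0 - A 0) := by rw [hr]; simp
  have r1 : P 1 = A 1 + r * (C 1 - A 1) := by rw [hr]; simp
  have s0 : P 0 = B 0 + s * (D 0 - B 0) := by rw [hs]; simp
  have s1 : P 1 = B 1 + s * (D 1 - B 1) := by rw [hs]; simp
  have x0 : Q 0 = A 0 + x * (B 0 - A 0) := by rw [hx]; simp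
  have x1 : Q 1 = A 1 + x * (B 1 - A 1) := by rw [hx]; simp
  have y0 : R 0 = C 0 + y * (D 0 - C 0) := by rw [hy]; simp
  have y1 : R 1 = C 1 + y * (D 1 - C 1) := by rw [hy]; simp
  have m0 : M 0 = (Oa 0 + Oc 0) / 2 := by
    rw [hM, midpoint_eq_smul_add]; simp; ring
  have m1 : M 1 = (Oa 1 + Oc 1) / 2 := by
    rw [hM, midpoint_eq_smul_add]; simp; ring
  have n0 : N 0 = (Ob 0 + Od 0) / 2 := by
    rw [hN, midpoint_eq_smul_add]; simp; ring
  have n1 : N 1 = (Ob 1 + Od 1) / 2 := by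
    rw [hN, midpoint_eq_smul_add]; simp; ring
  have q : (Q 0 - P 0) * (N 0 - M 0) + (Q 1 - P 1) * (N 1 - M 1) = 0 := by
    have := hQperp
    simp [PiLp.inner_apply, Fin.sum_univ_two] at this
    linarith
  have q' : (R 0 - P 0) * (N 0 - M 0) + (R 1 - P 1) * (N 1 - M 1) = 0 := by
    have := hRperp
    simp [PiLp.inner_apply, Fin.sum_univ_two] at this
    linarith
  have hw : ¬ (N 0 - M 0 = 0 ∧ N 1 - M 1 = 0) := by
    rintro ⟨h0, h1⟩
    apply hMN
    ext i
    fin_cases i <;> simp <;> linarith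
  suffices h : (Q 0 - P 0) + (R 0 - P 0) = 0 ∧ (Q 1 - P 1) + (R 1 - P 1) = 0 by
    rw [midpoint_eq_smul_add]
    ext i
    fin_cases i
    · simp; linarith [h.1]
    · simp; linarith [h.2]
  clear hr hs hx hy hM hN hQperp hRperp hOa hOb hOc hOd hPAC hPBD hQAB hRCD hABC hABD hACD hBCD
  clear hAB hAC hAD hBC hBD hCD hMN
  -- coordinates relative to `P`
  obtain ⟨u0, hu0⟩ : ∃ t, t = C 0 - A 0 := ⟨_, rfl⟩
  obtain ⟨u1, hu1⟩ : ∃ t, t = C 1 - A 1 := ⟨_, rfl⟩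
  obtain ⟨v0, hv0⟩ : ∃ t, t = D 0 - B 0 := ⟨_, rfl⟩
  obtain ⟨v1, hv1⟩ : ∃ t, t = D 1 - B 1 := ⟨_, rfl⟩
  have A0 : A 0 = P 0 + (-r) * u0 := by rw [hu0]; linarith
  have A1 : A 1 = P 1 + (-r) * u1 := by rw [hu1]; linarith
  have C0 : C 0 = P 0 + (1 - r) * u0 := by rw [hu0]; linarith
  have C1 : C 1 = P 1 + (1 - r) * u1 := by rw [hu1]; linarith
  have B0 : B 0 = P 0 + (-s) * v0 := by rw [hv0]; linarith
  have B1 : B 1 = P 1 + (-s) * v1 := by rw [hv1]; linarith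
  have D0 : D 0 = P 0 + (1 - s) * v0 := by rw [hv0]; linarith
  have D1 : D 1 = P 1 + (1 - s) * v1 := by rw [hv1]; linarith
  clear hu0 hu1 hv0 hv1 r0 r1 s0 s1
  obtain ⟨a, ha⟩ : ∃ t, t = -r := ⟨_, rfl⟩
  obtain ⟨c, hc⟩ : ∃ t, t = 1 - r := ⟨_, rfl⟩
  obtain ⟨b, hb⟩ : ∃ t, t = -s := ⟨_, rfl⟩
  obtain ⟨d, hd⟩ : ∃ t, t = 1 - s := ⟨_, rfl⟩
  have hac : a ≠ c := by intro h; linarith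
  have hbd : b ≠ d := by intro h; linarith
  rw [← ha] at A0 A1
  rw [← hc] at C0 C1
  rw [← hb] at B0 B1
  rw [← hd] at D0 D1
  rw [A0, A1, B0, B1, C0, C1] at dABC
  rw [A0, A1, B0, B1, D0, D1] at dABD
  rw [A0, A1, C0, C1, D0, D1] at dACD
  rw [B0, B1, C0, C1, D0, D1] at dBCD
  have hdet : u0 * v1 - u1 * v0 ≠ 0 := by
    intro h
    apply dABC
    linear_combination (-a * b + b * c) * (-1) * h
  have ha0 : a ≠ 0 := by
    rintro rfl
    apply dABD
    ring
  have hb0 : b ≠ 0 := by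
    rintro rfl
    apply dABC
    ring
  have hc0 : c ≠ 0 := by
    rintro rfl
    apply dBCD
    ring
  have hd0 : d ≠ 0 := by
    rintro rfl
    apply dACD
    ring
  rw [A0, B0] at x0
  rw [A1, B1] at x1
  rw [C0, D0] at y0
  rw [C1, D1] at y1
  rw [B0, B1, C0, C1] at a1
  rw [C0, C1, D0, D1] at a2
  rw [C0, C1, D0, D1] at b1
  rw [D0, D1, A0, A1] at b2
  rw [D0, D1, A0, A1] at c1
  rw [A0, A1, B0, B1] at c2
  rw [A0, A1, B0, B1] at d1
  rw [B0, B1, C0, C1] at d2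
  rw [x0, x1] at q
  rw [y0, y1] at q'
  rw [x0, x1, y0, y1]
  obtain ⟨U, hU⟩ : ∃ t, t = u0 ^ 2 + u1 ^ 2 := ⟨_, rfl⟩
  obtain ⟨V, hV⟩ : ∃ t, t = v0 ^ 2 + v1 ^ 2 := ⟨_, rfl⟩
  -- circumcenters
  obtain ⟨od1, od2⟩ := bf_circ (a := a) (b := b) (c := c) (U := U) (V := V)
    (s := (Od 0 - P 0) * u0 + (Od 1 - P 1) * u1) (t := (Od 0 - P 0) * v0 + (Od 1 - P 1) * v1)
    hb0 hac (by rw [hU, hV]; linear_combination d1) (by rw [hU]; linear_combination d1 + d2)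
  obtain ⟨ob1, ob2⟩ := bf_circ (a := a) (b := d) (c := c) (U := U) (V := V)
    (s := (Ob 0 - P 0) * u0 + (Ob 1 - P 1) * u1) (t := (Ob 0 - P 0) * v0 + (Ob 1 - P 1) * v1)
    hd0 hac (by rw [hU, hV]; linear_combination -b2) (by rw [hU]; linear_combination -b1 - b2)
  obtain ⟨oa1, oa2⟩ := bf_circ (a := b) (b := c) (c := d) (U := V) (V := U)
    (s := (Oa 0 - P 0) * v0 + (Oa 1 - P 1) * v1) (t := (Oa 0 - P 0) * u0 + (Oa 1 - P 1) * u1)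
    hc0 hbd (by rw [hU, hV]; linear_combination a1) (by rw [hV]; linear_combination a1 + a2)
  obtain ⟨oc1, oc2⟩ := bf_circ (a := b) (b := a) (c := d) (U := V) (V := U)
    (s := (Oc 0 - P 0) * v0 + (Oc 1 - P 1) * v1) (t := (Oc 0 - P 0) * u0 + (Oc 1 - P 1) * u1)
    ha0 hbd (by rw [hU, hV]; linear_combination -c2) (by rw [hV]; linear_combination -c1 - c2)
  have key := bf_core (K := (a * c * U - b * d * V) / 4) (x := x) (y := y)
    (wu := (N 0 - M 0) * u0 + (N 1 - M 1) * u1) (wv := (N 0 - M 0) * v0 + (N 1 - M 1) * v1)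
    ha0 hb0 hc0 hd0
    (by
      rintro ⟨h1, h2⟩
      apply hw
      constructor
      · apply mul_left_cancel₀ hdet
        linear_combination v1 * h1 - u1 * h2
      · apply mul_left_cancel₀ hdet
        linear_combination u0 * h2 - v0 * h1)
    (by
      rw [m0, m1, n0, n1]
      trans ((a + c) * U + (a + c) * U - (c * U + b * d * V / c) - (a * U + b * d * V / a)) / 4
      · rw [← oa2, ← oc2]
        linear_combination (ob1 + od1) / 4
      · field_simp
        ring)
    (by
      rw [m0, m1, n0, n1]
      trans ((b * V + a * c * U / b) + (d * V + a * c * U / d) - (b + d) * V - (b + d) * V) / 4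
      · rw [← ob2, ← od2]
        linear_combination -(oa1 + oc1) / 4
      · field_simp
        ring)
    (by linear_combination q) (by linear_combination q')
  obtain ⟨k1, k2⟩ := key
  constructor
  · linear_combination u0 * k1 + v0 * k2
  · linear_combination u1 * k1 + v1 * k2
end

section
/- Let ABCD be an arbitrary quadrilateral in the Euclidean plane whose diagonals AC and BD meet at a point P, and let M be the midpoint of the diagonal AC. Let O_a, O_b, O_c, O_d be the circumcenters of triangles BCD, CDA, DAB, ABC respectively (each triple being non-collinear). Then ⟪M − O_a, M − O_c⟫ · ⟪P − A, P − C⟫ = ⟪M − O_b, M − O_d⟫ · ⟪P − B, P − D⟫, where ⟪·,·⟫ denotes the inner product of vectors; that is, the ratio of the powers of M with respect to the circles with diameters O_aO_c and O_bO_d equals the ratio ⟪P − B, P − D⟫ / ⟪P − A, P − C⟫. -/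
open scoped InnerProductSpace

/-- Two-dimensional cross product criterion. -/
lemma cross_ne_of_not_collinear (A B C : EuclideanSpace ℝ (Fin 2)) (hAC : A ≠ C)
    (h : ¬ Collinear ℝ ({A, B, C} : Set (EuclideanSpace ℝ (Fin 2)))) :
    (B 0 - A 0) * (C 1 - A 1) - (B 1 - A 1) * (C 0 - A 0) ≠ 0 := by
  intro h0
  apply h
  rw [collinear_iff_of_mem (p₀ := A) (by simp)]
  have hU : (C 0 - A 0) ^ 2 + (C 1 - A 1) ^ 2 ≠ 0 := by
    intro hz
    apply hAC
    ext i
    fin_cases i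
    · show A 0 = C 0
      nlinarith [sq_nonneg (C 0 - A 0), sq_nonneg (C 1 - A 1)]
    · show A 1 = C 1
      nlinarith [sq_nonneg (C 0 - A 0), sq_nonneg (C 1 - A 1)]
  refine ⟨C - A, ?_⟩
  intro p hp
  simp only [Set.mem_insert_iff, Set.mem_singleton_iff] at hp
  rcases hp with rfl | rfl | rfl
  · exact ⟨0, by simp⟩
  · refine ⟨((p 0 - A 0) * (C 0 - A 0) + (p 1 - A 1) * (C 1 - A 1)) /
      ((C 0 - A 0) ^ 2 + (C 1 - A 1) ^ 2), ?_⟩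
    ext i
    fin_cases i
    · simp
      field_simp
      linear_combination (C 1 - A 1) * h0
    · simp
      field_simp
      linear_combination -(C 0 - A 0) * h0
  · exact ⟨1, by simp⟩

/-- A point collinear with two distinct points is on their line. -/
lemma exists_param (A C P : EuclideanSpace ℝ (Fin 2)) (hAC : A ≠ C)
    (h : Collinear ℝ ({A, C, P} : Set (EuclideanSpace ℝ (Fin 2)))) :
    ∃ t : ℝ, ∀ i, P i = A i + t * (C i - A i) := by
  rw [collinear_iff_of_mem (p₀ := A) (by simp)] at h
  obtain ⟨v, hv⟩ := h
  obtain ⟨r, hr⟩ := hv C (by simp)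
  obtain ⟨q, hq⟩ := hv P (by simp)
  have hr0 : r ≠ 0 := by
    rintro rfl
    apply hAC
    simp [hr]
  refine ⟨q / r, fun i => ?_⟩
  rw [hq, hr]
  simp
  field_simp
  ring

/-- Equal distances in coordinates. -/
lemma dist_eq_coord (O X Y : EuclideanSpace ℝ (Fin 2)) (h : dist O X = dist O Y) :
    (O 0 - X 0) ^ 2 + (O 1 - X 1) ^ 2 = (O 0 - Y 0) ^ 2 + (O 1 - Y 1) ^ 2 := by
  have h2 : dist O X ^ 2 = dist O Y ^ 2 := by rw [h]
  simpa [EuclideanSpace.dist_sq_eq, Fin.sum_univ_two, Real.dist_eq, sq_abs] using h2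

/-- The purely algebraic core: `P` is `(p, q)`, `A = P + a u`, `C = P + (a+1) u`,
`B = P + b v`, `D = P + (b+1) v`; all circumcenters are taken relative to `P`. -/
lemma core (a b c d u0 u1 v0 v1 m0 m1 x0 x1 y0 y1 z0 z1 w0 w1 : ℝ)
    (hc : c = a + 1) (hd : d = b + 1)
    (ha0 : a ≠ 0) (hb0 : b ≠ 0) (hc0 : c ≠ 0) (hd0 : d ≠ 0) (hw : u0 * v1 - u1 * v0 ≠ 0)
    (hm0 : 2 * m0 = (a + c) * u0) (hm1 : 2 * m1 = (a + c) * u1)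
    (hx1 : (x0 - b * v0) ^ 2 + (x1 - b * v1) ^ 2 = (x0 - c * u0) ^ 2 + (x1 - c * u1) ^ 2)
    (hx2 : (x0 - c * u0) ^ 2 + (x1 - c * u1) ^ 2 = (x0 - d * v0) ^ 2 + (x1 - d * v1) ^ 2)
    (hy1 : (y0 - c * u0) ^ 2 + (y1 - c * u1) ^ 2 = (y0 - d * v0) ^ 2 + (y1 - d * v1) ^ 2)
    (hy2 : (y0 - d * v0) ^ 2 + (y1 - d * v1) ^ 2 = (y0 - a * u0) ^ 2 + (y1 - a * u1) ^ 2)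
    (hz1 : (z0 - d * v0) ^ 2 + (z1 - d * v1) ^ 2 = (z0 - a * u0) ^ 2 + (z1 - a * u1) ^ 2)
    (hz2 : (z0 - a * u0) ^ 2 + (z1 - a * u1) ^ 2 = (z0 - b * v0) ^ 2 + (z1 - b * v1) ^ 2)
    (hw1 : (w0 - a * u0) ^ 2 + (w1 - a * u1) ^ 2 = (w0 - b * v0) ^ 2 + (w1 - b * v1) ^ 2)
    (hw2 : (w0 - b * v0) ^ 2 + (w1 - b * v1) ^ 2 = (w0 - c * u0) ^ 2 + (w1 - c * u1) ^ 2) :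
    ((m0 - x0) * (m0 - z0) + (m1 - x1) * (m1 - z1)) * (a * c * (u0 ^ 2 + u1 ^ 2)) =
    ((m0 - y0) * (m0 - w0) + (m1 - y1) * (m1 - w1)) * (b * d * (v0 ^ 2 + v1 ^ 2)) := by
  obtain ⟨U, hU⟩ : ∃ U, U = u0 ^ 2 + u1 ^ 2 := ⟨_, rfl⟩
  obtain ⟨V, hV⟩ : ∃ V, V = v0 ^ 2 + v1 ^ 2 := ⟨_, rfl⟩
  obtain ⟨G, hG⟩ : ∃ G, G = u0 * v0 + u1 * v1 := ⟨_, rfl⟩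
  have gram : ∀ p0 p1 q0 q1 : ℝ, (u0 * v1 - u1 * v0) ^ 2 * (p0 * q0 + p1 * q1) =
      V * (p0 * u0 + p1 * u1) * (q0 * u0 + q1 * u1)
      - G * ((p0 * u0 + p1 * u1) * (q0 * v0 + q1 * v1) +
        (q0 * u0 + q1 * u1) * (p0 * v0 + p1 * v1))
      + U * (p0 * v0 + p1 * v1) * (q0 * v0 + q1 * v1) := by
    intros; subst hU hV hG; ring
  -- components along `u` and `v`
  have mu : 2 * (m0 * u0 + m1 * u1) = (a + c) * U := by
    subst hU; linear_combination u0 * hm0 + u1 * hm1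
  have mv : 2 * (m0 * v0 + m1 * v1) = (a + c) * G := by
    subst hG; linear_combination v0 * hm0 + v1 * hm1
  have xv : 2 * (x0 * v0 + x1 * v1) = (b + d) * V := by
    subst hV hd; linear_combination hx1 + hx2
  have zv : 2 * (z0 * v0 + z1 * v1) = (b + d) * V := by
    subst hV hd; linear_combination - hz1 - hz2
  have yu : 2 * (y0 * u0 + y1 * u1) = (a + c) * U := by
    subst hU hc; linear_combination - hy1 - hy2
  have wu : 2 * (w0 * u0 + w1 * u1) = (a + c) * U := by
    subst hU hc; linear_combination hw1 + hw2
  have xu : 2 * c * (x0 * u0 + x1 * u1) = c ^ 2 * U + b * d * V := by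
    have := xv
    subst hU hV
    linear_combination hx1 + b * xv
  have zu : 2 * a * (z0 * u0 + z1 * u1) = a ^ 2 * U + b * d * V := by
    subst hU hV
    linear_combination -hz2 + b * zv
  have yv : 2 * d * (y0 * v0 + y1 * v1) = d ^ 2 * V + a * c * U := by
    subst hU hV
    linear_combination -hy2 + a * yu
  have wv : 2 * b * (w0 * v0 + w1 * v1) = b ^ 2 * V + a * c * U := by
    subst hU hV
    linear_combination hw1 + a * wu
  have e1 : 2 * c * ((m0 - x0) * u0 + (m1 - x1) * u1) = a * c * U - b * d * V := by
    linear_combination c * mu - xu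
  have e2 : 2 * a * ((m0 - z0) * u0 + (m1 - z1) * u1) = a * c * U - b * d * V := by
    linear_combination a * mu - zu
  have e3 : (m0 - x0) * v0 + (m1 - x1) * v1 = ((a + c) * G - (b + d) * V) / 2 := by
    linear_combination (mv - xv) / 2
  have e4 : (m0 - z0) * v0 + (m1 - z1) * v1 = ((a + c) * G - (b + d) * V) / 2 := by
    linear_combination (mv - zv) / 2
  have e5 : (m0 - y0) * u0 + (m1 - y1) * u1 = 0 := by
    linear_combination (mu - yu) / 2
  have e6 : (m0 - w0) * u0 + (m1 - w1) * u1 = 0 := by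
    linear_combination (mu - wu) / 2
  have e7 : 2 * d * ((m0 - y0) * v0 + (m1 - y1) * v1)
      = (a + c) * d * G - d ^ 2 * V - a * c * U := by
    linear_combination d * mv - yv
  have e8 : 2 * b * ((m0 - w0) * v0 + (m1 - w1) * v1)
      = (a + c) * b * G - b ^ 2 * V - a * c * U := by
    linear_combination b * mv - wv
  have g1 := gram (m0 - x0) (m1 - x1) (m0 - z0) (m1 - z1)
  have g2 := gram (m0 - y0) (m1 - y1) (m0 - w0) (m1 - w1)
  rw [e3, e4] at g1
  rw [e5, e6] at g2
  rw [← hU, ← hV]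
  apply mul_left_cancel₀ (pow_ne_zero 2 hw)
  generalize (m0 - x0) * u0 + (m1 - x1) * u1 = X at *
  generalize (m0 - z0) * u0 + (m1 - z1) * u1 = Z at *
  generalize (m0 - y0) * v0 + (m1 - y1) * v1 = Y at *
  generalize (m0 - w0) * v0 + (m1 - w1) * v1 = W at *
  generalize (m0 - x0) * (m0 - z0) + (m1 - x1) * (m1 - z1) = I at *
  generalize (m0 - y0) * (m0 - w0) + (m1 - y1) * (m1 - w1) = J at *
  have f1 : 4 * (a * c) * (X * Z) = (a * c * U - b * d * V) ^ 2 := by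
    linear_combination (2 * a * Z) * e1 + (a * c * U - b * d * V) * e2
  have f2 : 2 * (a * c) * (X + Z) = (a + c) * (a * c * U - b * d * V) := by
    linear_combination a * e1 + c * e2
  have f3 : 4 * (b * d) * (Y * W) = ((a + c) * d * G - d ^ 2 * V - a * c * U) *
      ((a + c) * b * G - b ^ 2 * V - a * c * U) := by
    linear_combination (2 * b * W) * e7 + ((a + c) * d * G - d ^ 2 * V - a * c * U) * e8
  linear_combination (a * c * U) * g1 - (b * d * V) * g2 + U * V / 4 * f1
    - U * G * ((a + c) * G - (b + d) * V) / 4 * f2 - U * V / 4 * f3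

/-- Let `ABCD` be a quadrilateral whose diagonals `AC` and `BD` meet at `P`, let `M`
be the midpoint of the diagonal `AC`, and let `Oa`, `Ob`, `Oc`, `Od` be the
circumcenters of triangles `BCD`, `CDA`, `DAB`, `ABC`.  Then the ratio of the powers
of `M` with respect to the circles with diameters `OaOc` and `ObOd` equals
`⟪P - B, P - D⟫ / ⟪P - A, P - C⟫`; in product form:
`⟪M - Oa, M - Oc⟫ * ⟪P - A, P - C⟫ = ⟪M - Ob, M - Od⟫ * ⟪P - B, P - D⟫`. -/
theorem power_ratio_at_midpoint_of_AC
    (A B C D P M Oa Ob Oc Od : EuclideanSpace ℝ (Fin 2))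
    (hAB : A ≠ B) (hAC : A ≠ C) (hAD : A ≠ D) (hBC : B ≠ C) (hBD : B ≠ D) (hCD : C ≠ D)
    (hABC : ¬ Collinear ℝ ({A, B, C} : Set (EuclideanSpace ℝ (Fin 2))))
    (hABD : ¬ Collinear ℝ ({A, B, D} : Set (EuclideanSpace ℝ (Fin 2))))
    (hACD : ¬ Collinear ℝ ({A, C, D} : Set (EuclideanSpace ℝ (Fin 2))))
    (hBCD : ¬ Collinear ℝ ({B, C, D} : Set (EuclideanSpace ℝ (Fin 2))))
    (hPAC : Collinear ℝ ({A, C, P} : Set (EuclideanSpace ℝ (Fin 2))))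
    (hPBD : Collinear ℝ ({B, D, P} : Set (EuclideanSpace ℝ (Fin 2))))
    (hM : M = midpoint ℝ A C)
    (hOa : dist Oa B = dist Oa C ∧ dist Oa C = dist Oa D)
    (hOb : dist Ob C = dist Ob D ∧ dist Ob D = dist Ob A)
    (hOc : dist Oc D = dist Oc A ∧ dist Oc A = dist Oc B)
    (hOd : dist Od A = dist Od B ∧ dist Od B = dist Od C) :
    ⟪M - Oa, M - Oc⟫_ℝ * ⟪P - A, P - C⟫_ℝ = ⟪M - Ob, M - Od⟫_ℝ * ⟪P - B, P - D⟫_ℝ := by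
  obtain ⟨t, ht⟩ := exists_param A C P hAC hPAC
  obtain ⟨s, hs⟩ := exists_param B D P hBD hPBD
  have k1 := cross_ne_of_not_collinear A B C hAC hABC
  have k2 := cross_ne_of_not_collinear A B D hAD hABD
  have k3 := cross_ne_of_not_collinear A C D hAD hACD
  have k4 := cross_ne_of_not_collinear B C D hBD hBCD
  have t0 := ht 0
  have t1 := ht 1
  have s0 := hs 0
  have s1 := hs 1
  obtain ⟨u0, hu0⟩ : ∃ x, x = C 0 - A 0 := ⟨_, rfl⟩
  obtain ⟨u1, hu1⟩ : ∃ x, x = C 1 - A 1 := ⟨_, rfl⟩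
  obtain ⟨v0, hv0⟩ : ∃ x, x = D 0 - B 0 := ⟨_, rfl⟩
  obtain ⟨v1, hv1⟩ : ∃ x, x = D 1 - B 1 := ⟨_, rfl⟩
  rw [← hu0] at t0
  rw [← hu1] at t1
  rw [← hv0] at s0
  rw [← hv1] at s1
  have A0 : A 0 = P 0 + (-t) * u0 := by linarith
  have A1 : A 1 = P 1 + (-t) * u1 := by linarith
  have C0 : C 0 = P 0 + (1 - t) * u0 := by linarith
  have C1 : C 1 = P 1 + (1 - t) * u1 := by linarith
  have B0 : B 0 = P 0 + (-s) * v0 := by linarith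
  have B1 : B 1 = P 1 + (-s) * v1 := by linarith
  have D0 : D 0 = P 0 + (1 - s) * v0 := by linarith
  have D1 : D 1 = P 1 + (1 - s) * v1 := by linarith
  have M0 : M 0 = (A 0 + C 0) / 2 := by
    rw [hM, midpoint_eq_smul_add]; simp; ring
  have M1 : M 1 = (A 1 + C 1) / 2 := by
    rw [hM, midpoint_eq_smul_add]; simp; ring
  have a1 := dist_eq_coord _ _ _ hOa.1
  have a2 := dist_eq_coord _ _ _ hOa.2
  have b1 := dist_eq_coord _ _ _ hOb.1
  have b2 := dist_eq_coord _ _ _ hOb.2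
  have c1 := dist_eq_coord _ _ _ hOc.1
  have c2 := dist_eq_coord _ _ _ hOc.2
  have d1 := dist_eq_coord _ _ _ hOd.1
  have d2 := dist_eq_coord _ _ _ hOd.2
  rw [A0, A1, B0, B1, C0, C1] at k1
  rw [A0, A1, B0, B1, D0, D1] at k2
  rw [B0, B1, C0, C1, D0, D1] at k4
  simp only [A0, A1, B0, B1, C0, C1, D0, D1] at a1 a2 b1 b2 c1 c2 d1 d2 M0 M1
  have nb : -s ≠ 0 := fun h => k1 (by rw [h]; ring)
  have na : -t ≠ 0 := fun h => k2 (by rw [h]; ring)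
  have nw : u0 * v1 - u1 * v0 ≠ 0 := fun h => k1 (by linear_combination s * h)
  have nc : 1 - t ≠ 0 := fun h => k4 (by rw [h]; ring)
  have nd : 1 - s ≠ 0 := by
    intro h
    rw [A0, A1, C0, C1, D0, D1] at k3
    exact k3 (by rw [h]; ring)
  have key := core (-t) (-s) (1 - t) (1 - s) u0 u1 v0 v1 (M 0 - P 0) (M 1 - P 1)
    (Oa 0 - P 0) (Oa 1 - P 1) (Ob 0 - P 0) (Ob 1 - P 1) (Oc 0 - P 0) (Oc 1 - P 1)
    (Od 0 - P 0) (Od 1 - P 1) (by ring) (by ring) na nb nc nd nw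
    (by rw [M0]; ring) (by rw [M1]; ring)
    (by linear_combination a1) (by linear_combination a2)
    (by linear_combination b1) (by linear_combination b2)
    (by linear_combination c1) (by linear_combination c2)
    (by linear_combination d1) (by linear_combination d2)
  simp only [PiLp.inner_apply, Fin.sum_univ_two, PiLp.sub_apply, RCLike.inner_apply, conj_trivial]
  rw [A0, A1, B0, B1, C0, C1, D0, D1]
  linear_combination key
end

section
/- Let ABCD be an arbitrary quadrilateral in the Euclidean plane whose diagonals AC and BD meet at a point P. Let X be the intersection point of the perpendicular bisectors of segments AC and BD, let Y be the intersection point of the perpendicular bisectors of segments AB and CD, and let Z be the intersection point of the perpendicular bisectors of segments AD and BC (assume each pair of perpendicular bisectors is non-parallel). Let W = Y + Z − X, and assume W ≠ P. Let U be the intersection point of lines AD and BC, and let V be the intersection point of lines AB and CD (assume these pairs of lines are non-parallel and U ≠ V). Then the line PW is perpendicular to the line UV. -/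
open AffineSubspace
open scoped InnerProductSpace

lemma core_real (a b c d p q x1 x2 y1 y2 z1 z2 m n k l : ℝ)
    (ha : a ≠ 0) (hb : b ≠ 0) (hc : c ≠ 0) (hd : d ≠ 0) (hac : a ≠ c) (hbd : b ≠ d)
    (hX1 : a ^ 2 * p - 2 * a * x1 = c ^ 2 * p - 2 * c * x1)
    (hX2 : b ^ 2 * q - 2 * b * x2 = d ^ 2 * q - 2 * d * x2)
    (hY1 : a ^ 2 * p - 2 * a * y1 = b ^ 2 * q - 2 * b * y2)
    (hY2 : c ^ 2 * p - 2 * c * y1 = d ^ 2 * q - 2 * d * y2)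
    (hZ1 : a ^ 2 * p - 2 * a * z1 = d ^ 2 * q - 2 * d * z2)
    (hZ2 : b ^ 2 * q - 2 * b * z2 = c ^ 2 * p - 2 * c * z1)
    (hu1 : (1 - m) * a = n * c) (hu2 : m * d = (1 - n) * b)
    (hv1 : (1 - k) * a = (1 - l) * c) (hv2 : k * b = l * d) :
    (y1 + z1 - x1) * ((1 - k) * a - (1 - m) * a) + (y2 + z2 - x2) * (k * b - m * d) = 0 := by
  have h1 : a * d - b * c ≠ 0 := by
    intro h
    have e : c * (b - d) = 0 ∨ a * (b - d) = 0 := by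
      right
      linear_combination b * hv1 + a * hv2 - (1 - l) * h
    rcases e with e | e <;> rcases mul_eq_zero.1 e with e | e
    · exact hc e
    · exact hbd (sub_eq_zero.1 e)
    · exact ha e
    · exact hbd (sub_eq_zero.1 e)
  have h2 : a * b - d * c ≠ 0 := by
    intro h
    have e : a * (d - b) = 0 := by
      linear_combination d * hu1 + a * hu2 - n * h
    rcases mul_eq_zero.1 e with e | e
    · exact ha e
    · exact hbd (sub_eq_zero.1 e).symm
  have hx1 : x1 = (a + c) * p / 2 := by
    have : (a - c) * (x1 - (a + c) * p / 2) = 0 := by linear_combination (-1 / 2) * hX1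
    rcases mul_eq_zero.1 this with e | e
    · exact absurd (sub_eq_zero.1 e) hac
    · exact sub_eq_zero.1 e
  have hx2 : x2 = (b + d) * q / 2 := by
    have : (b - d) * (x2 - (b + d) * q / 2) = 0 := by linear_combination (-1 / 2) * hX2
    rcases mul_eq_zero.1 this with e | e
    · exact absurd (sub_eq_zero.1 e) hbd
    · exact sub_eq_zero.1 e
  have hy1 : y1 = (d * (a^2*p - b^2*q) - b * (c^2*p - d^2*q)) / (2 * (a * d - b * c)) := by
    rw [eq_div_iff (by simpa using h1)]; linear_combination -d * hY1 + b * hY2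
  have hy2 : y2 = (c * (a^2*p - b^2*q) - a * (c^2*p - d^2*q)) / (2 * (a * d - b * c)) := by
    rw [eq_div_iff (by simpa using h1)]; linear_combination -c * hY1 + a * hY2
  have hz1 : z1 = (b * (a^2*p - d^2*q) - d * (c^2*p - b^2*q)) / (2 * (a * b - d * c)) := by
    rw [eq_div_iff (by simpa using h2)]; linear_combination -b * hZ1 - d * hZ2
  have hz2 : z2 = (c * (a^2*p - d^2*q) - a * (c^2*p - b^2*q)) / (2 * (a * b - d * c)) := by
    rw [eq_div_iff (by simpa using h2)]; linear_combination -c * hZ1 - a * hZ2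
  have hw : (a * c * (b + d)) * (y1 + z1 - x1) = (b * d * (a + c)) * (y2 + z2 - x2) := by
    have h1' : a * d - c * b ≠ 0 := by rwa [mul_comm c b]
    have h2' : a * b - c * d ≠ 0 := by rwa [mul_comm c d]
    rw [hx1, hx2, hy1, hy2, hz1, hz2, mul_comm b c, mul_comm d c]
    field_simp
    ring
  have hdel : (b * d * (a + c)) * ((1 - k) * a - (1 - m) * a)
      + (a * c * (b + d)) * (k * b - m * d) = 0 := by
    linear_combination a * b * d * hv1 + a * b * c * hv2 - a * b * d * hu1 - a * c * d * hu2
  generalize (1 - k) * a - (1 - m) * a = s at *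
  generalize k * b - m * d = t at *
  generalize y1 + z1 - x1 = w1 at *
  generalize y2 + z2 - x2 = w2 at *
  by_cases hN : b + d = 0
  · have hM : b * d * (a + c) ≠ 0 := by
      refine mul_ne_zero (mul_ne_zero hb hd) ?_
      intro h
      apply h1
      linear_combination a * hN - b * h
    refine (mul_eq_zero.1 (?_ : b * d * (a + c) * _ = 0)).resolve_left hM
    linear_combination w1 * hdel - t * hw
  · refine (mul_eq_zero.1 (?_ : a * c * (b + d) * _ = 0)).resolve_left
      (mul_ne_zero (mul_ne_zero ha hc) hN)
    linear_combination w2 * hdel + s * hw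

abbrev E2 := EuclideanSpace ℝ (Fin 2)

lemma col_param {A B C : E2} (hAB : A ≠ B) (h : Collinear ℝ ({A, B, C} : Set E2)) :
    ∃ t : ℝ, C = A + t • (B - A) := by
  have := h.mem_affineSpan_of_mem_of_ne (p₁ := A) (p₂ := B) (p₃ := C)
    (by simp) (by simp) (by simp) hAB
  obtain ⟨t, ht⟩ := mem_affineSpan_pair_iff_exists_lineMap_eq.1 this
  refine ⟨t, ?_⟩
  rw [← ht, AffineMap.lineMap_apply]
  simp [add_comm]

lemma col_of (P e : E2) (r s t : ℝ) {A B C : E2} (hA : A = P + r • e) (hB : B = P + s • e)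
    (hC : C = P + t • e) : Collinear ℝ ({A, B, C} : Set E2) := by
  rw [collinear_iff_exists_forall_eq_smul_vadd]
  refine ⟨P, e, ?_⟩
  rintro x (rfl | rfl | rfl)
  · exact ⟨r, by simp [hA, add_comm]⟩
  · exact ⟨s, by simp [hB, add_comm]⟩
  · exact ⟨t, by simp [hC, add_comm]⟩

lemma dist_expand (P X e f A B : E2) (a b : ℝ) (hA : A = P + a • e) (hB : B = P + b • f)
    (h : dist X A = dist X B) :
    a ^ 2 * ⟪e, e⟫_ℝ - 2 * a * ⟪X - P, e⟫_ℝ = b ^ 2 * ⟪f, f⟫_ℝ - 2 * b * ⟪X - P, f⟫_ℝ := by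
  have h2 : ⟪(X - P) - a • e, (X - P) - a • e⟫_ℝ = ⟪(X - P) - b • f, (X - P) - b • f⟫_ℝ := by
    rw [real_inner_self_eq_norm_sq, real_inner_self_eq_norm_sq]
    rw [dist_eq_norm, dist_eq_norm, hA, hB] at h
    rw [sub_sub, sub_sub, h]
  simp only [inner_sub_left, inner_sub_right, inner_smul_left, inner_smul_right,
    real_inner_comm (X - P) e, real_inner_comm (X - P) f] at h2
  simp only [conj_trivial] at h2
  simp only [inner_sub_left, inner_sub_right, real_inner_comm e, real_inner_comm f] at h2 ⊢
  linarith

/-- Let `ABCD` be an arbitrary quadrilateral whose diagonals `AC` and `BD` meet at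
`P`.  The perpendicular bisectors of `AC` and `BD` meet at `X`, those of `AB` and
`CD` meet at `Y`, those of `AD` and `BC` meet at `Z`; let `W = Y + Z - X` with
`W ≠ P`.  Let `U` be the intersection of lines `AD` and `BC`, and `V` the
intersection of lines `AB` and `CD`, with `U ≠ V`.  Then the line `PW` is
perpendicular to the line `UV`. -/
theorem PW_perp_UV
    (A B C D P X Y Z W U V : EuclideanSpace ℝ (Fin 2))
    (hAB : A ≠ B) (hAC : A ≠ C) (hAD : A ≠ D) (hBC : B ≠ C) (hBD : B ≠ D) (hCD : C ≠ D)
    (hABC : ¬ Collinear ℝ ({A, B, C} : Set (EuclideanSpace ℝ (Fin 2))))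
    (hABD : ¬ Collinear ℝ ({A, B, D} : Set (EuclideanSpace ℝ (Fin 2))))
    (hACD : ¬ Collinear ℝ ({A, C, D} : Set (EuclideanSpace ℝ (Fin 2))))
    (hBCD : ¬ Collinear ℝ ({B, C, D} : Set (EuclideanSpace ℝ (Fin 2))))
    (hPAC : Collinear ℝ ({A, C, P} : Set (EuclideanSpace ℝ (Fin 2))))
    (hPBD : Collinear ℝ ({B, D, P} : Set (EuclideanSpace ℝ (Fin 2))))
    -- `X` is the intersection point of the perpendicular bisectors of `AC` and `BD`
    (hX : dist X A = dist X C ∧ dist X B = dist X D)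
    (hXuniq : ∀ X' : EuclideanSpace ℝ (Fin 2),
      dist X' A = dist X' C → dist X' B = dist X' D → X' = X)
    -- `Y` is the intersection point of the perpendicular bisectors of `AB` and `CD`
    (hY : dist Y A = dist Y B ∧ dist Y C = dist Y D)
    (hYuniq : ∀ Y' : EuclideanSpace ℝ (Fin 2),
      dist Y' A = dist Y' B → dist Y' C = dist Y' D → Y' = Y)
    -- `Z` is the intersection point of the perpendicular bisectors of `AD` and `BC`
    (hZ : dist Z A = dist Z D ∧ dist Z B = dist Z C)
    (hZuniq : ∀ Z' : EuclideanSpace ℝ (Fin 2),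
      dist Z' A = dist Z' D → dist Z' B = dist Z' C → Z' = Z)
    (hW : W = Y + Z - X) (hWP : W ≠ P)
    (hUAD : Collinear ℝ ({A, D, U} : Set (EuclideanSpace ℝ (Fin 2))))
    (hUBC : Collinear ℝ ({B, C, U} : Set (EuclideanSpace ℝ (Fin 2))))
    (hVAB : Collinear ℝ ({A, B, V} : Set (EuclideanSpace ℝ (Fin 2))))
    (hVCD : Collinear ℝ ({C, D, V} : Set (EuclideanSpace ℝ (Fin 2))))
    (hUV : U ≠ V) :
    ⟪W - P, V - U⟫_ℝ = 0 := by
  obtain ⟨t, ht⟩ := col_param hAC hPAC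
  obtain ⟨s, hs⟩ := col_param hBD hPBD
  obtain ⟨m, hm⟩ := col_param hAD hUAD
  obtain ⟨n, hn⟩ := col_param hBC hUBC
  obtain ⟨k, hk⟩ := col_param hAB hVAB
  obtain ⟨l, hl⟩ := col_param hCD hVCD
  obtain ⟨e, he⟩ : ∃ e, e = C - A := ⟨_, rfl⟩
  obtain ⟨f, hf⟩ : ∃ f, f = D - B := ⟨_, rfl⟩
  obtain ⟨a, ha⟩ : ∃ a : ℝ, a = -t := ⟨_, rfl⟩
  obtain ⟨c, hc⟩ : ∃ c : ℝ, c = 1 - t := ⟨_, rfl⟩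
  obtain ⟨b, hb⟩ : ∃ b : ℝ, b = -s := ⟨_, rfl⟩
  obtain ⟨d, hd⟩ : ∃ d : ℝ, d = 1 - s := ⟨_, rfl⟩
  have eA : A = P + a • e := by rw [ht, ha, he]; module
  have eC : C = P + c • e := by rw [ht, hc, he]; module
  have eB : B = P + b • f := by rw [hs, hb, hf]; module
  have eD : D = P + d • f := by rw [hs, hd, hf]; module
  have hac : a ≠ c := by rw [ha, hc]; intro h; linarith
  have hbd : b ≠ d := by rw [hb, hd]; intro h; linarith
  have ha0 : a ≠ 0 := fun h => hABD (col_of P f 0 b d (by rw [eA, h]; simp) eB eD)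
  have hc0 : c ≠ 0 := fun h => hBCD (col_of P f b 0 d eB (by rw [eC, h]; simp) eD)
  have hb0 : b ≠ 0 := fun h => hABC (col_of P e a 0 c eA (by rw [eB, h]; simp) eC)
  have hd0 : d ≠ 0 := fun h => hACD (col_of P e a c 0 eA eC (by rw [eD, h]; simp))
  have hf0 : f ≠ 0 := by rw [hf]; exact sub_ne_zero.2 hBD.symm
  have ind : ∀ x y x' y' : ℝ, x • e + y • f = x' • e + y' • f → x = x' ∧ y = y' := by
    intro x y x' y' h
    have h0 : (x - x') • e = (y' - y) • f := by
      rw [sub_smul, sub_smul, sub_eq_sub_iff_add_eq_add, h, add_comm]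
    by_cases hx : x - x' = 0
    · rw [hx, zero_smul] at h0
      have := (smul_eq_zero.1 h0.symm).resolve_right hf0
      exact ⟨by linarith, by linarith⟩
    · exfalso
      have h1 : e = ((x - x')⁻¹ * (y' - y)) • f := by
        rw [mul_smul, ← h0, smul_smul, inv_mul_cancel₀ hx, one_smul]
      refine hABD (col_of P f (a * ((x - x')⁻¹ * (y' - y))) b d ?_ eB eD)
      rw [mul_smul, ← h1]; exact eA
  have eU : U = P + (((1 - m) * a) • e + (m * d) • f) := by rw [hm, eA, eD]; module
  have eU' : U = P + ((n * c) • e + ((1 - n) * b) • f) := by rw [hn, eB, eC]; module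
  have eV : V = P + (((1 - k) * a) • e + (k * b) • f) := by rw [hk, eA, eB]; module
  have eV' : V = P + (((1 - l) * c) • e + (l * d) • f) := by rw [hl, eC, eD]; module
  obtain ⟨hu1, hu2⟩ := ind _ _ _ _ (add_left_cancel (eU.symm.trans eU'))
  obtain ⟨hv1, hv2⟩ := ind _ _ _ _ (add_left_cancel (eV.symm.trans eV'))
  have key := core_real a b c d _ _ _ _ _ _ _ _ m n k l ha0 hb0 hc0 hd0 hac hbd
    (dist_expand P X e e A C a c eA eC hX.1) (dist_expand P X f f B D b d eB eD hX.2)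
    (dist_expand P Y e f A B a b eA eB hY.1) (dist_expand P Y e f C D c d eC eD hY.2)
    (dist_expand P Z e f A D a d eA eD hZ.1) (dist_expand P Z f e B C b c eB eC hZ.2)
    hu1 hu2 hv1 hv2
  have eVU : V - U = ((1 - k) * a - (1 - m) * a) • e + (k * b - m * d) • f := by
    rw [eV, eU]; module
  have eW : W - P = (Y - P) + (Z - P) - (X - P) := by rw [hW]; abel
  rw [eVU, eW, inner_add_right, inner_smul_right, inner_smul_right]
  simp only [inner_sub_left (Y - P + (Z - P)), inner_add_left]
  linear_combination key
end
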